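/- Let (X, μ) be a σ-finite measure space and r a positive integer. For each s ∈ ℕ let h_s : X → Matrix (Fin r) (Fin r) ℂ and let h : X → Matrix (Fin r) (Fin r) ℂ be measurable maps such that for μ-a.e. x: every h_s(x) is a positive definite Hermitian matrix, h_s(x) ⪯ h_{s+1}(x) in the Loewner order, and h_s(x) → h(x) entrywise as s → ∞. Let C ≥ 0 and let f_s : X → ℂ^r be measurable functions with ∫ Re⟪f_s(x), h_s(x) f_s(x)⟫ dμ(x) ≤ C² for every s. Then there exist a measurable function f : X → ℂ^r and a strictly increasing map φ : ℕ → ℕ such that (i) ∫ Re⟪f(x), h(x) f(x)⟫ dμ(x) ≤ C², and (ii) for every t ∈ ℕ and every measurable g : X → ℂ^r with ∫ Re⟪g(x), h_t(x) g(x)⟫ dμ(x) < ∞, one has ∫ ⟪g(x), h_t(x) f_{φ(k)}(x)⟫ dμ(x) → ∫ ⟪g(x), h_t(x) f(x)⟫ dμ(x) as k → ∞. -/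

import Mathlib

open MeasureTheory Filter Topology Matrix
open scoped ComplexOrder

lemma weak_seq_compact {H : Type*} [NormedAddCommGroup H] [InnerProductSpace ℂ H]
    [CompleteSpace H] (u : ℕ → H) (C : ℝ) (hu : ∀ k, ‖u k‖ ≤ C) :
    ∃ (v : H) (φ : ℕ → ℕ), StrictMono φ ∧
      ∀ g : H, Tendsto (fun k => inner ℂ g (u (φ k))) atTop (𝓝 (inner ℂ g v)) := by
  let K : Submodule ℂ H := (Submodule.span ℂ (Set.range u)).topologicalClosure
  have hKc : IsClosed (K : Set H) := Submodule.isClosed_topologicalClosure _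
  have : CompleteSpace K := hKc.completeSpace_coe
  have hsep : TopologicalSpace.IsSeparable (K : Set H) := by
    have h1 : TopologicalSpace.IsSeparable (Submodule.span ℂ (Set.range u) : Set H) :=
      (Set.countable_range u).isSeparable.span
    simpa [K, Submodule.topologicalClosure_coe] using h1.closure
  have : TopologicalSpace.SeparableSpace K := hsep.separableSpace
  have huK : ∀ k, u k ∈ K := fun k =>
    Submodule.le_topologicalClosure _ (Submodule.subset_span ⟨k, rfl⟩)
  let w : ℕ → K := fun k => ⟨u k, huK k⟩
  let D : ℕ → WeakDual ℂ K := fun k =>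
    StrongDual.toWeakDual (InnerProductSpace.toDual ℂ K (w k))
  have hD : ∀ k, D k ∈ (WeakDual.toStrongDual ⁻¹' Metric.closedBall (0 : StrongDual ℂ K) C) := by
    intro k
    have : ‖InnerProductSpace.toDual ℂ K (w k)‖ ≤ C := by
      rw [LinearIsometryEquiv.norm_map]; exact hu k
    exact (mem_closedBall_zero_iff (E := StrongDual ℂ K)).mpr this
  obtain ⟨L, -, φ, hφ, hL⟩ := WeakDual.isSeqCompact_closedBall ℂ K 0 C hD
  let v : K := (InnerProductSpace.toDual ℂ K).symm (WeakDual.toStrongDual L)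
  refine ⟨(v : H), φ, hφ, fun g => ?_⟩
  have hev : ∀ y : K, Tendsto (fun k => D (φ k) y) atTop (𝓝 (L y)) := fun y =>
    ((WeakDual.eval_continuous y).tendsto L).comp hL
  have key := hev (K.orthogonalProjectionOnto g)
  have e1 : ∀ k, D (φ k) (K.orthogonalProjectionOnto g) = inner ℂ (u (φ k)) g := by
    intro k
    have : D (φ k) (K.orthogonalProjectionOnto g)
      = inner ℂ (w (φ k)) (K.orthogonalProjectionOnto g) := rfl
    rw [this, Submodule.inner_orthogonalProjectionOnto_eq_of_mem_left]
  have e2 : L (K.orthogonalProjectionOnto g) = inner ℂ (v : H) g := by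
    have : L (K.orthogonalProjectionOnto g) = inner ℂ v (K.orthogonalProjectionOnto g) := by
      simp only [v]
      rw [InnerProductSpace.toDual_symm_apply]; rfl
    rw [this, Submodule.inner_orthogonalProjectionOnto_eq_of_mem_left]
  simp only [e1, e2] at key
  have := (Complex.continuous_conj.tendsto _).comp key
  simpa [Function.comp_def, inner_conj_symm] using this

open scoped MatrixOrder Matrix.Norms.L2Operator in
lemma cs_psd {r : ℕ} {H : Matrix (Fin r) (Fin r) ℂ} (hH : H.PosSemidef) (g v : Fin r → ℂ) :
    ‖star g ⬝ᵥ H *ᵥ v‖ ≤ √((star g ⬝ᵥ H *ᵥ g).re) * √((star v ⬝ᵥ H *ᵥ v).re) := by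
  obtain ⟨B, rfl⟩ := CStarAlgebra.nonneg_iff_eq_star_mul_self.mp hH.nonneg
  rw [Matrix.star_eq_conjTranspose]
  have e : ∀ a b : Fin r → ℂ, star a ⬝ᵥ (Bᴴ * B) *ᵥ b =
      inner ℂ (WithLp.toLp 2 (B *ᵥ a)) (WithLp.toLp 2 (B *ᵥ b)) := by
    intro a b
    rw [EuclideanSpace.inner_toLp_toLp, ← Matrix.mulVec_mulVec, Matrix.dotProduct_mulVec,
      ← Matrix.star_mulVec, dotProduct_comm]
  rw [e, e, e]
  have n1 := fun a : EuclideanSpace ℂ (Fin r) => norm_eq_sqrt_re_inner (𝕜 := ℂ) a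
  simp only [RCLike.re_eq_complex_re] at n1
  rw [← n1, ← n1]
  exact norm_inner_le_norm _ _

lemma mass_bound {r : ℕ} {H : Matrix (Fin r) (Fin r) ℂ} (hH : H.PosDef) (v : Fin r → ℂ) :
    ∑ i, ‖v i‖ ^ 2 ≤ (1 + ∑ i, ‖H⁻¹ i i‖) * (star v ⬝ᵥ H *ᵥ v).re := by
  have hq : 0 ≤ (star v ⬝ᵥ H *ᵥ v).re :=
    (Complex.le_def.mp (hH.posSemidef.dotProduct_mulVec_nonneg v)).1
  have hdet : IsUnit H.det := (Matrix.isUnit_iff_isUnit_det _).mp hH.isUnit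
  have hstep : ∀ i, ‖v i‖ ^ 2 ≤ ‖H⁻¹ i i‖ * (star v ⬝ᵥ H *ᵥ v).re := by
    intro i
    let a : Fin r → ℂ := H⁻¹ *ᵥ Pi.single i 1
    have ha : H *ᵥ a = Pi.single i 1 := by
      simp only [a]
      rw [Matrix.mulVec_mulVec, Matrix.mul_nonsing_inv _ hdet, Matrix.one_mulVec]
    have hs : ∀ w, star a ⬝ᵥ H *ᵥ w = w i := by
      intro w
      rw [Matrix.dotProduct_mulVec]
      have : star a ᵥ* H = star (H *ᵥ a) := by
        rw [Matrix.star_mulVec H, hH.isHermitian.eq]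
      rw [this, ha]
      simp
    have := cs_psd hH.posSemidef a v
    rw [hs, hs] at this
    have hai : a i = H⁻¹ i i := by simp [a]
    rw [hai] at this
    calc ‖v i‖ ^ 2 ≤ (√((H⁻¹ i i).re) * √((star v ⬝ᵥ H *ᵥ v).re)) ^ 2 := by gcongr
      _ ≤ (√(‖H⁻¹ i i‖) * √((star v ⬝ᵥ H *ᵥ v).re)) ^ 2 := by
          gcongr; exact Complex.re_le_norm _
      _ = _ := by rw [mul_pow, Real.sq_sqrt (norm_nonneg _), Real.sq_sqrt hq]
  calc ∑ i, ‖v i‖ ^ 2 ≤ ∑ i, ‖H⁻¹ i i‖ * (star v ⬝ᵥ H *ᵥ v).re :=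
        Finset.sum_le_sum fun i _ => hstep i
    _ = (∑ i, ‖H⁻¹ i i‖) * (star v ⬝ᵥ H *ᵥ v).re := by rw [Finset.sum_mul]
    _ ≤ _ := by nlinarith

lemma measurable_inv_diag {X : Type*} [MeasurableSpace X] {r : ℕ}
    (h : X → Matrix (Fin r) (Fin r) ℂ) (hm : ∀ i j, Measurable fun x => h x i j) (i : Fin r) :
    Measurable fun x => (h x)⁻¹ i i := by
  have hdet : ∀ k : X → Matrix (Fin r) (Fin r) ℂ, (∀ i j, Measurable fun x => k x i j) →
      Measurable fun x => (k x).det := by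
    intro k hk
    simp only [Matrix.det_apply]
    refine Finset.measurable_fun_sum _ fun σ _ => ?_
    exact (Finset.measurable_fun_prod _ fun j _ => hk _ _).const_smul (Equiv.Perm.sign σ)
  simp only [Matrix.inv_def, Matrix.smul_apply, Ring.inverse_eq_inv', smul_eq_mul,
    Matrix.adjugate_apply]
  refine (hdet h hm).inv.mul (hdet _ fun a b => ?_)
  by_cases hai : a = i
  · subst hai; simp
  · simpa [Matrix.updateRow_ne hai] using hm a b

lemma measurable_mulVec {X : Type*} [MeasurableSpace X] {r : ℕ}
    {h : X → Matrix (Fin r) (Fin r) ℂ} (hm : ∀ i j, Measurable fun x => h x i j)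
    {v : X → Fin r → ℂ} (hv : Measurable v) : Measurable fun x => h x *ᵥ v x := by
  refine measurable_pi_lambda _ fun i => ?_
  simp only [Matrix.mulVec, dotProduct]
  exact Finset.measurable_fun_sum _ fun j _ => (hm i j).mul ((measurable_pi_apply j).comp hv)

lemma measurable_sesq {X : Type*} [MeasurableSpace X] {r : ℕ}
    {h : X → Matrix (Fin r) (Fin r) ℂ} (hm : ∀ i j, Measurable fun x => h x i j)
    {g v : X → Fin r → ℂ} (hg : Measurable g) (hv : Measurable v) :
    Measurable fun x => star (g x) ⬝ᵥ h x *ᵥ v x := by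
  have h2 := measurable_mulVec hm hv
  simp only [dotProduct]
  refine Finset.measurable_fun_sum _ fun j _ => ?_
  refine Measurable.mul ?_ ((measurable_pi_apply j).comp h2)
  exact Complex.continuous_conj.measurable.comp ((measurable_pi_apply j).comp hg)

lemma holder_sesq {X : Type*} [MeasurableSpace X] (μ : Measure X) {r : ℕ}
    {h : X → Matrix (Fin r) (Fin r) ℂ} (hm : ∀ i j, Measurable fun x => h x i j)
    (hp : ∀ᵐ x ∂μ, (h x).PosSemidef)
    {g v : X → Fin r → ℂ} (hg : Measurable g) (hv : Measurable v) :
    ∫⁻ x, ‖star (g x) ⬝ᵥ h x *ᵥ v x‖ₑ ∂μ ≤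
      (∫⁻ x, ENNReal.ofReal ((star (g x) ⬝ᵥ h x *ᵥ g x).re) ∂μ) ^ (1 / 2 : ℝ) *
      (∫⁻ x, ENNReal.ofReal ((star (v x) ⬝ᵥ h x *ᵥ v x).re) ∂μ) ^ (1 / 2 : ℝ) := by
  have hq : ∀ {w : X → Fin r → ℂ}, Measurable w →
      Measurable fun x => ENNReal.ofReal (√((star (w x) ⬝ᵥ h x *ᵥ w x).re)) := fun hw =>
    (Complex.measurable_re.comp (measurable_sesq hm hw hw)).sqrt.ennreal_ofReal
  have hsq : ∀ a : ℝ, ENNReal.ofReal (√a) ^ (2 : ℝ) = ENNReal.ofReal a := by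
    intro a
    rcases le_total 0 a with ha | ha
    · rw [ENNReal.ofReal_rpow_of_nonneg (Real.sqrt_nonneg _) (by norm_num)]
      congr 1
      rw [Real.rpow_two, Real.sq_sqrt ha]
    · simp [Real.sqrt_eq_zero_of_nonpos ha, ENNReal.ofReal_of_nonpos ha]
  have := ENNReal.lintegral_mul_le_Lp_mul_Lq μ Real.HolderConjugate.two_two
    (hq hg).aemeasurable (hq hv).aemeasurable
  simp only [hsq] at this
  refine le_trans (lintegral_mono_ae ?_) this
  filter_upwards [hp] with x hx
  rw [← ofReal_norm, Pi.mul_apply, ← ENNReal.ofReal_mul (Real.sqrt_nonneg _)]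
  exact ENNReal.ofReal_le_ofReal (cs_psd hx _ _)

lemma weak_core {X : Type*} [MeasurableSpace X] (μ : Measure X) {r : ℕ}
    (σ : X → ℝ) (hσm : Measurable σ) (hσ : ∀ x, 0 < σ x)
    (F : ℕ → X → Fin r → ℂ) (hF : ∀ k, Measurable (F k)) (C : ℝ) (hC : 0 ≤ C)
    (hb : ∀ k, ∫⁻ x, ENNReal.ofReal ((σ x)⁻¹ ^ 2 * ∑ i, ‖F k x i‖ ^ 2) ∂μ
      ≤ ENNReal.ofReal (C ^ 2)) :
    ∃ (flim : X → Fin r → ℂ) (φ : ℕ → ℕ), Measurable flim ∧ StrictMono φ ∧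
      ∀ w : X → Fin r → ℂ, Measurable w → ∀ E, MeasurableSet E → μ E < ⊤ → ∀ M : ℝ,
        (∀ x ∈ E, σ x * ‖(WithLp.toLp 2 (w x) : EuclideanSpace ℂ (Fin r))‖ ≤ M) →
        Tendsto (fun k => ∫ x in E, star (w x) ⬝ᵥ F (φ k) x ∂μ) atTop
          (𝓝 (∫ x in E, star (w x) ⬝ᵥ flim x ∂μ)) := by
  have htoLp : Measurable (fun v : Fin r → ℂ => (WithLp.toLp 2 v : EuclideanSpace ℂ (Fin r))) :=
    (PiLp.continuous_toLp 2 _).measurable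
  have hofLp : Measurable (fun v : EuclideanSpace ℂ (Fin r) => (WithLp.ofLp v : Fin r → ℂ)) :=
    (PiLp.continuous_ofLp 2 _).measurable
  let U : ℕ → X → EuclideanSpace ℂ (Fin r) := fun k x => (σ x)⁻¹ • WithLp.toLp 2 (F k x)
  have hUm : ∀ k, Measurable (U k) := fun k => hσm.inv.smul (htoLp.comp (hF k))
  have hUn : ∀ k, eLpNorm (U k) 2 μ ≤ ENNReal.ofReal C := by
    intro k
    rw [eLpNorm_eq_lintegral_rpow_enorm_toReal (by norm_num) (by norm_num)]
    have e : ∀ x, ‖U k x‖ₑ ^ (ENNReal.toReal 2) =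
        ENNReal.ofReal ((σ x)⁻¹ ^ 2 * ∑ i, ‖F k x i‖ ^ 2) := by
      intro x
      rw [← ofReal_norm, ENNReal.ofReal_rpow_of_nonneg (norm_nonneg _) (by simp)]
      congr 1
      simp only [ENNReal.toReal_ofNat, Real.rpow_two, U, norm_smul, mul_pow]
      rw [EuclideanSpace.norm_sq_eq]
      simp
    simp only [e]
    calc _ ≤ (ENNReal.ofReal (C ^ 2)) ^ (1 / ENNReal.toReal 2) := by gcongr; exact hb k
      _ = _ := by
        rw [ENNReal.ofReal_rpow_of_nonneg (by positivity) (by simp)]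
        congr 1
        rw [ENNReal.toReal_ofNat, ← Real.sqrt_eq_rpow, Real.sqrt_sq hC]
  have hUL : ∀ k, MemLp (U k) 2 μ := fun k =>
    ⟨(hUm k).aestronglyMeasurable, (hUn k).trans_lt ENNReal.ofReal_lt_top⟩
  obtain ⟨v, φ, hφ, hv⟩ := weak_seq_compact (fun k => (hUL k).toLp (U k)) C (by
    intro k
    rw [Lp.norm_toLp]
    exact ENNReal.toReal_le_of_le_ofReal hC (hUn k))
  have hvm : Measurable (v : X → EuclideanSpace ℂ (Fin r)) := (Lp.stronglyMeasurable v).measurable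
  refine ⟨fun x => σ x • WithLp.ofLp (v x), φ, hσm.smul (hofLp.comp hvm), hφ, ?_⟩
  intro w hw E hE hEfin M hM
  let W : X → EuclideanSpace ℂ (Fin r) := E.indicator fun x => σ x • WithLp.toLp 2 (w x)
  have hWm : Measurable fun x => σ x • (WithLp.toLp 2 (w x) : EuclideanSpace ℂ (Fin r)) :=
    hσm.smul (htoLp.comp hw)
  have hWL : MemLp W 2 μ := by
    rw [memLp_indicator_iff_restrict hE]
    have : IsFiniteMeasure (μ.restrict E) := ⟨by simpa using hEfin⟩
    refine MemLp.of_bound hWm.aestronglyMeasurable M ?_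
    filter_upwards [ae_restrict_mem hE] with x hx
    rw [norm_smul, Real.norm_of_nonneg (hσ x).le]
    exact hM x hx
  have key := hv (hWL.toLp W)
  have e1 : ∀ k, inner ℂ (hWL.toLp W) ((hUL k).toLp (U k)) =
      ∫ x in E, star (w x) ⬝ᵥ F k x ∂μ := by
    intro k
    rw [L2.inner_def, ← integral_indicator hE]
    refine integral_congr_ae ?_
    filter_upwards [hWL.coeFn_toLp, (hUL k).coeFn_toLp] with x h1 h2
    rw [h1, h2]
    by_cases hx : x ∈ E
    · have h3 : ((σ x : ℝ) : ℂ) ≠ 0 := by exact_mod_cast (hσ x).ne'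
      simp only [W, U, Set.indicator_of_mem hx, ← Complex.coe_smul, inner_smul_left,
        inner_smul_right, Complex.conj_ofReal, EuclideanSpace.inner_toLp_toLp]
      rw [dotProduct_comm]
      push_cast
      field_simp
    · simp [W, Set.indicator_of_notMem hx]
  have e2 : inner ℂ (hWL.toLp W) v =
      ∫ x in E, star (w x) ⬝ᵥ (σ x • WithLp.ofLp (v x)) ∂μ := by
    rw [L2.inner_def, ← integral_indicator hE]
    refine integral_congr_ae ?_
    filter_upwards [hWL.coeFn_toLp] with x h1
    rw [h1]
    by_cases hx : x ∈ E
    · simp only [W, Set.indicator_of_mem hx, ← Complex.coe_smul, inner_smul_left,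
        Complex.conj_ofReal, EuclideanSpace.inner_eq_star_dotProduct, dotProduct_smul]
      rw [dotProduct_comm, smul_eq_mul]
    · simp [W, Set.indicator_of_notMem hx]
  simp only [e1, e2] at key
  exact key

lemma tendsto_approx {a : ℕ → ℂ} {b : ℂ}
    (H : ∀ ε > 0, ∃ (a' : ℕ → ℂ) (b' : ℂ), Tendsto a' atTop (𝓝 b') ∧
      (∀ᶠ k in atTop, dist (a k) (a' k) ≤ ε) ∧ dist b b' ≤ ε) : Tendsto a atTop (𝓝 b) := by
  rw [Metric.tendsto_atTop']
  intro ε hε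
  obtain ⟨a', b', h1, h2, h3⟩ := H (ε / 4) (by positivity)
  have h4 := h1.eventually (Metric.ball_mem_nhds b' (show 0 < ε / 4 by positivity))
  obtain ⟨N, hN⟩ := eventually_atTop.mp (h2.and h4)
  refine ⟨N, fun n hn => ?_⟩
  obtain ⟨h5, h6⟩ := hN n hn.le
  have h7 : dist (a' n) b' < ε / 4 := h6
  have := dist_triangle4 (a n) (a' n) b' b
  rw [dist_comm b' b] at this
  linarith

lemma le_of_le_sqrt_mul {a c : ENNReal} (ha : a ≠ ⊤) (h : a ≤ a ^ (1 / 2 : ℝ) * c ^ (1 / 2 : ℝ)) :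
    a ≤ c := by
  by_contra hlt
  push Not at hlt
  have ha0 : a ≠ 0 := (bot_le.trans_lt hlt).ne'
  have h1 : c ^ (1 / 2 : ℝ) < a ^ (1 / 2 : ℝ) := ENNReal.rpow_lt_rpow hlt (by norm_num)
  have h2 : a ^ (1 / 2 : ℝ) * a ^ (1 / 2 : ℝ) = a := by
    rw [← ENNReal.rpow_add _ _ ha0 ha]; norm_num
  have h3 : a ^ (1 / 2 : ℝ) * c ^ (1 / 2 : ℝ) < a ^ (1 / 2 : ℝ) * a ^ (1 / 2 : ℝ) := by
    refine ENNReal.mul_lt_mul_right ?_ ?_ h1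
    · simp [ENNReal.rpow_eq_zero_iff, ha0]
    · exact ENNReal.rpow_ne_top_of_nonneg (by norm_num) ha
  rw [h2] at h3
  exact absurd h (not_le.mpr h3)

/-- Weak-compactness lemma of Guan–Mi–Yuan: sections `f_s` with uniformly bounded
`L²`-norms with respect to an increasing (in the Loewner order) sequence of
measurable positive definite Hermitian matrix-valued metrics `h_s ↗ h` admit a
subsequence converging weakly in each weighted space `L²(h_t)`, with limit `f`
satisfying the same bound with respect to `h`. -/
theorem stmt2 {X : Type*} [MeasurableSpace X] (μ : Measure X) [SigmaFinite μ]
    (r : ℕ) (hr : 0 < r)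
    (h : ℕ → X → Matrix (Fin r) (Fin r) ℂ) (hlim : X → Matrix (Fin r) (Fin r) ℂ)
    (hmeas : ∀ s i j, Measurable fun x => h s x i j)
    (hlimmeas : ∀ i j, Measurable fun x => hlim x i j)
    (hpos : ∀ᵐ x ∂μ, ∀ s, (h s x).PosDef ∧ (h s x).IsHermitian)
    (hmono : ∀ᵐ x ∂μ, ∀ s, (h (s + 1) x - h s x).PosSemidef)
    (hconv : ∀ᵐ x ∂μ, ∀ i j, Tendsto (fun s => h s x i j) atTop (𝓝 (hlim x i j)))
    (C : ℝ) (hC : 0 ≤ C)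
    (f : ℕ → X → Fin r → ℂ) (hfmeas : ∀ s, Measurable (f s))
    (hfbd : ∀ s, ∫⁻ x, ENNReal.ofReal ((star (f s x) ⬝ᵥ (h s x) *ᵥ f s x).re) ∂μ
      ≤ ENNReal.ofReal (C ^ 2)) :
    ∃ (flim : X → Fin r → ℂ) (φ : ℕ → ℕ), Measurable flim ∧ StrictMono φ ∧
      (∫⁻ x, ENNReal.ofReal ((star (flim x) ⬝ᵥ (hlim x) *ᵥ flim x).re) ∂μ
        ≤ ENNReal.ofReal (C ^ 2)) ∧
      (∀ t : ℕ, ∀ g : X → Fin r → ℂ, Measurable g →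
        (∫⁻ x, ENNReal.ofReal ((star (g x) ⬝ᵥ (h t x) *ᵥ g x).re) ∂μ) < ⊤ →
        Tendsto (fun k => ∫ x, star (g x) ⬝ᵥ (h t x) *ᵥ f (φ k) x ∂μ) atTop
          (𝓝 (∫ x, star (g x) ⬝ᵥ (h t x) *ᵥ flim x ∂μ))) := by
  classical
  let q : ℕ → (X → Fin r → ℂ) → X → ENNReal := fun t g x =>
    ENNReal.ofReal ((star (g x) ⬝ᵥ (h t x) *ᵥ g x).re)
  have hqm : ∀ t g, Measurable g → Measurable (q t g) := fun t g hg =>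
    (Complex.measurable_re.comp (measurable_sesq (hmeas t) hg hg)).ennreal_ofReal
  have hpsd : ∀ t, ∀ᵐ x ∂μ, (h t x).PosSemidef := fun t => by
    filter_upwards [hpos] with x hx using (hx t).1.posSemidef
  have hmon : ∀ᵐ x ∂μ, ∀ (v : Fin r → ℂ) (s t : ℕ), s ≤ t →
      (star v ⬝ᵥ (h s x) *ᵥ v).re ≤ (star v ⬝ᵥ (h t x) *ᵥ v).re := by
    filter_upwards [hmono] with x hx v s t hst
    refine monotone_nat_of_le_succ (f := fun s => (star v ⬝ᵥ (h s x) *ᵥ v).re) (fun n => ?_) hst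
    have := (Complex.le_def.mp ((hx n).dotProduct_mulVec_nonneg v)).1
    rw [Matrix.sub_mulVec, dotProduct_sub] at this
    simpa using this
  have hbd : ∀ t k, t ≤ k → ∫⁻ x, q t (f k) x ∂μ ≤ ENNReal.ofReal (C ^ 2) := by
    intro t k htk
    refine le_trans (lintegral_mono_ae ?_) (hfbd k)
    filter_upwards [hmon] with x hx
    exact ENNReal.ofReal_le_ofReal (hx _ _ _ htk)
  let σ : X → ℝ := fun x => √(1 + ∑ i, ‖(h 0 x)⁻¹ i i‖)
  have hτ : ∀ x, 0 < 1 + ∑ i, ‖(h 0 x)⁻¹ i i‖ := fun x => by positivity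
  have hσm : Measurable σ := by
    refine Measurable.sqrt (measurable_const.add ?_)
    exact Finset.measurable_fun_sum _ fun i _ => (measurable_inv_diag _ (hmeas 0) i).norm
  have hσ : ∀ x, 0 < σ x := fun x => Real.sqrt_pos.mpr (hτ x)
  obtain ⟨flim, φ, hflim, hφ, hweak⟩ := weak_core μ σ hσm hσ f hfmeas C hC (by
    intro k
    refine le_trans (lintegral_mono_ae ?_) (hbd 0 k (Nat.zero_le _))
    filter_upwards [hpos] with x hx
    refine ENNReal.ofReal_le_ofReal ?_
    rw [inv_pow, Real.sq_sqrt (hτ x).le, inv_mul_le_iff₀ (hτ x)]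
    exact mass_bound (hx 0).1 _)
  let E : ℕ → (X → Fin r → ℂ) → ℕ → Set X := fun t g n => spanningSets μ n ∩
    {x | σ x * ‖(WithLp.toLp 2 (h t x *ᵥ g x) : EuclideanSpace ℂ (Fin r))‖ ≤ n ∧
      (star (g x) ⬝ᵥ (h t x) *ᵥ g x).re ≤ n}
  have hEm : ∀ t g, Measurable g → ∀ n, MeasurableSet (E t g n) := by
    intro t g hg n
    refine (measurableSet_spanningSets μ n).inter (MeasurableSet.inter ?_ ?_)
    · refine measurableSet_le (hσm.mul (Measurable.norm ?_)) measurable_const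
      exact (PiLp.continuous_toLp 2 _).measurable.comp (measurable_mulVec (hmeas t) hg)
    · exact measurableSet_le (Complex.measurable_re.comp (measurable_sesq (hmeas t) hg hg))
        measurable_const
  have hEfin : ∀ t g n, μ (E t g n) < ⊤ := fun t g n =>
    (measure_mono Set.inter_subset_left).trans_lt (measure_spanningSets_lt_top μ n)
  have hEmono : ∀ t g, Monotone (E t g) := by
    intro t g m n hmn x hx
    have hmn' : (m : ℝ) ≤ n := by exact_mod_cast hmn
    exact ⟨monotone_spanningSets μ hmn hx.1, hx.2.1.trans hmn', hx.2.2.trans hmn'⟩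
  have hEU : ∀ t g, ⋃ n, E t g n = Set.univ := by
    intro t g
    refine Set.eq_univ_of_forall fun x => ?_
    have hx : x ∈ ⋃ n, spanningSets μ n := by rw [iUnion_spanningSets]; trivial
    obtain ⟨n1, h1⟩ := Set.mem_iUnion.mp hx
    obtain ⟨n2, h2⟩ := exists_nat_ge
      (σ x * ‖(WithLp.toLp 2 (h t x *ᵥ g x) : EuclideanSpace ℂ (Fin r))‖)
    obtain ⟨n3, h3⟩ := exists_nat_ge ((star (g x) ⬝ᵥ (h t x) *ᵥ g x).re)
    refine Set.mem_iUnion.mpr ⟨max n1 (max n2 n3), monotone_spanningSets μ (le_max_left _ _) h1,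
      h2.trans ?_, h3.trans ?_⟩
    · exact_mod_cast (le_max_left _ _).trans (le_max_right _ _)
    · exact_mod_cast (le_max_right _ _).trans (le_max_right _ _)
  have hloc : ∀ t g, Measurable g → ∀ n,
      Tendsto (fun k => ∫ x in E t g n, star (g x) ⬝ᵥ (h t x) *ᵥ f (φ k) x ∂μ) atTop
        (𝓝 (∫ x in E t g n, star (g x) ⬝ᵥ (h t x) *ᵥ flim x ∂μ)) := by
    intro t g hg n
    have e : ∀ v : X → Fin r → ℂ, ∫ x in E t g n, star (g x) ⬝ᵥ (h t x) *ᵥ v x ∂μ =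
        ∫ x in E t g n, star (h t x *ᵥ g x) ⬝ᵥ v x ∂μ := by
      intro v
      refine integral_congr_ae ?_
      filter_upwards [ae_restrict_of_ae hpos] with x hx
      rw [Matrix.star_mulVec, (hx t).2.eq, Matrix.dotProduct_mulVec]
    simp only [e]
    exact hweak _ (measurable_mulVec (hmeas t) hg) _ (hEm t g hg n) (hEfin t g n) n
      fun x hx => hx.2.1
  have hhold : ∀ t (S : Set X) (g v : X → Fin r → ℂ), Measurable g → Measurable v →
      ∫⁻ x in S, ‖star (g x) ⬝ᵥ h t x *ᵥ v x‖ₑ ∂μ ≤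
        (∫⁻ x in S, q t g x ∂μ) ^ (1 / 2 : ℝ) * (∫⁻ x, q t v x ∂μ) ^ (1 / 2 : ℝ) := by
    intro t S g v hg hv
    refine (holder_sesq (μ.restrict S) (hmeas t) (ae_restrict_of_ae (hpsd t)) hg hv).trans ?_
    gcongr
    exact Measure.restrict_le_self
  have hloc_bd : ∀ t n, ∫⁻ x in E t flim n, q t flim x ∂μ ≤ ENNReal.ofReal (C ^ 2) := by
    intro t n
    have hfin : ∫⁻ x in E t flim n, q t flim x ∂μ ≠ ⊤ := by
      refine ne_top_of_le_ne_top ?_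
        (setLIntegral_mono (μ := μ) (s := E t flim n) (g := fun _ => ENNReal.ofReal n)
        measurable_const fun x hx => ENNReal.ofReal_le_ofReal hx.2.2)
      rw [setLIntegral_const]
      exact ENNReal.mul_ne_top ENNReal.ofReal_ne_top (hEfin t flim n).ne
    refine le_of_le_sqrt_mul hfin ?_
    have hint : Integrable (fun x => star (flim x) ⬝ᵥ h t x *ᵥ flim x)
        (μ.restrict (E t flim n)) := by
      refine ⟨(measurable_sesq (hmeas t) hflim hflim).aestronglyMeasurable, ?_⟩
      refine (holder_sesq (μ.restrict _) (hmeas t) (ae_restrict_of_ae (hpsd t))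
        hflim hflim).trans_lt ?_
      exact ENNReal.mul_lt_top (ENNReal.rpow_lt_top_of_nonneg (by norm_num) hfin)
        (ENNReal.rpow_lt_top_of_nonneg (by norm_num) hfin)
    have h1 : ∫⁻ x in E t flim n, q t flim x ∂μ ≤
        ‖∫ x in E t flim n, star (flim x) ⬝ᵥ h t x *ᵥ flim x ∂μ‖ₑ := by
      rw [← ofReal_norm]
      have hre := ofReal_integral_eq_lintegral_ofReal hint.re (by
        filter_upwards [ae_restrict_of_ae (hpsd t)] with x hx
        exact (Complex.le_def.mp (hx.dotProduct_mulVec_nonneg (flim x))).1)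
      have hre2 : ∫ x in E t flim n, RCLike.re (star (flim x) ⬝ᵥ h t x *ᵥ flim x) ∂μ =
        (∫ x in E t flim n, star (flim x) ⬝ᵥ h t x *ᵥ flim x ∂μ).re := integral_re hint
      rw [hre2] at hre
      refine hre.symm.le.trans (ENNReal.ofReal_le_ofReal (Complex.re_le_norm _))
    refine h1.trans ?_
    refine le_of_tendsto ((continuous_enorm.tendsto _).comp (hloc t flim hflim n)) ?_
    filter_upwards [eventually_ge_atTop t] with k hk
    refine (enorm_integral_le_lintegral_enorm _).trans ((hhold t _ _ _ hflim (hfmeas _)).trans ?_)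
    gcongr
    exact hbd t (φ k) (hk.trans hφ.le_apply)
  have hlim_bd : ∀ t, ∫⁻ x, q t flim x ∂μ ≤ ENNReal.ofReal (C ^ 2) := by
    intro t
    have hE1 : ∀ S, MeasurableSet S →
        μ.withDensity (q t flim) S = ∫⁻ x in S, q t flim x ∂μ :=
      fun S hS => withDensity_apply _ hS
    have h1 := (hEmono t flim).measure_iUnion (μ := μ.withDensity (q t flim))
    rw [hEU, hE1 _ MeasurableSet.univ, Measure.restrict_univ] at h1
    rw [h1]
    exact iSup_le fun n => by rw [hE1 _ (hEm t flim hflim n)]; exact hloc_bd t n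
  refine ⟨flim, φ, hflim, hφ, ?_, ?_⟩
  · have h1 : ∫⁻ x, ENNReal.ofReal ((star (flim x) ⬝ᵥ (hlim x) *ᵥ flim x).re) ∂μ =
        ∫⁻ x, liminf (fun t => q t flim x) atTop ∂μ := by
      refine lintegral_congr_ae ?_
      filter_upwards [hconv] with x hx
      have : Tendsto (fun t => q t flim x) atTop
          (𝓝 (ENNReal.ofReal ((star (flim x) ⬝ᵥ (hlim x) *ᵥ flim x).re))) := by
        refine ENNReal.tendsto_ofReal ((Complex.continuous_re.tendsto _).comp ?_)
        simp only [dotProduct, Matrix.mulVec]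
        refine tendsto_finsetSum _ fun i _ => Tendsto.const_mul _ ?_
        exact tendsto_finsetSum _ fun j _ => (hx i j).mul_const _
      exact this.liminf_eq.symm
    rw [h1]
    refine (lintegral_liminf_le fun t => hqm t flim hflim).trans ?_
    refine (liminf_le_liminf (Eventually.of_forall hlim_bd)).trans ?_
    simp
  · intro t g hg hgfin
    have hgfin' : ∫⁻ x, q t g x ∂μ < ⊤ := hgfin
    have hint : ∀ v, Measurable v → ∫⁻ x, q t v x ∂μ ≤ ENNReal.ofReal (C ^ 2) →
        Integrable (fun x => star (g x) ⬝ᵥ h t x *ᵥ v x) μ := by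
      intro v hv hvb
      refine ⟨(measurable_sesq (hmeas t) hg hv).aestronglyMeasurable, ?_⟩
      refine (holder_sesq μ (hmeas t) (hpsd t) hg hv).trans_lt ?_
      exact ENNReal.mul_lt_top (ENNReal.rpow_lt_top_of_nonneg (by norm_num) hgfin.ne)
        (ENNReal.rpow_lt_top_of_nonneg (by norm_num) (hvb.trans_lt ENNReal.ofReal_lt_top).ne)
    have htail : Tendsto (fun n => (∫⁻ x in (E t g n)ᶜ, q t g x ∂μ) ^ (1 / 2 : ℝ) *
        ENNReal.ofReal (C ^ 2) ^ (1 / 2 : ℝ)) atTop (𝓝 0) := by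
      have h1 : Tendsto (fun n => μ.withDensity (q t g) (E t g n)ᶜ) atTop
          (𝓝 (μ.withDensity (q t g) (⋂ n, (E t g n)ᶜ))) := by
        refine tendsto_measure_iInter_atTop
          (fun n => (hEm t g hg n).compl.nullMeasurableSet) ?_ ⟨0, ?_⟩
        · exact fun m n hmn => Set.compl_subset_compl.mpr (hEmono t g hmn)
        · refine ((measure_mono (Set.subset_univ _)).trans_lt ?_).ne
          rw [withDensity_apply _ MeasurableSet.univ, Measure.restrict_univ]
          exact hgfin'
      rw [← Set.compl_iUnion, hEU, Set.compl_univ, measure_empty] at h1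
      simp only [withDensity_apply _ (hEm t g hg _).compl] at h1
      have h2 := (ENNReal.continuous_rpow_const (y := (1 / 2 : ℝ))).tendsto 0 |>.comp h1
      rw [ENNReal.zero_rpow_of_pos (by norm_num)] at h2
      have h3 := ENNReal.Tendsto.mul_const (b := ENNReal.ofReal (C ^ 2) ^ (1 / 2 : ℝ)) h2
        (Or.inr (ENNReal.rpow_ne_top_of_nonneg (by norm_num) ENNReal.ofReal_ne_top))
      simpa [Function.comp_def] using h3
    refine tendsto_approx fun ε hε => ?_
    obtain ⟨n, hn⟩ := ((ENNReal.tendsto_nhds_zero.mp htail) (ENNReal.ofReal ε)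
      (ENNReal.ofReal_pos.mpr hε)).exists
    have hdist : ∀ v, Measurable v → ∫⁻ x, q t v x ∂μ ≤ ENNReal.ofReal (C ^ 2) →
        dist (∫ x, star (g x) ⬝ᵥ h t x *ᵥ v x ∂μ)
          (∫ x in E t g n, star (g x) ⬝ᵥ h t x *ᵥ v x ∂μ) ≤ ε := by
      intro v hv hvb
      rw [← integral_add_compl (hEm t g hg n) (hint v hv hvb), dist_eq_norm, add_sub_cancel_left,
        ← ENNReal.ofReal_le_ofReal_iff hε.le, ofReal_norm]
      refine (enorm_integral_le_lintegral_enorm _).trans ((hhold t _ _ _ hg hv).trans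
        (le_trans ?_ hn))
      gcongr
    refine ⟨_, _, hloc t g hg n, ?_, hdist flim hflim (hlim_bd t)⟩
    filter_upwards [eventually_ge_atTop t] with k hk
    exact hdist _ (hfmeas _) (hbd t (φ k) (hk.trans hφ.le_apply))
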